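/- Let (𝓜, M, ā) be a pointed system of parameter size n and let α be an ordinal. There is an L^◇_∞-formula θ^{𝓜,M,ā}_α with n free variables, of modal-quantifier rank exactly α, such that for every pointed system (𝓝, N, b̄) of parameter size n (over any potentialist system 𝓝): 𝓝, N ⊨ θ^{𝓜,M,ā}_α[b̄] if and only if Rank(M, ā, N, b̄) ≥ α in the game board MEF(𝓜, 𝓝). -/

import Mathlib

open FirstOrder Language

namespace Potentialist

/-- The underlying data of a potentialist system: a collection of worlds, each carrying a
first-order `L`-structure. -/
structure PreSys.{u, v, w, x} (L : FirstOrder.Language.{u, v}) where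
  World : Type w
  Dom : World → Type x
  str : ∀ W, L.Structure (Dom W)

attribute [instance] PreSys.str

/-- A potentialist system: a collection of first-order `L`-structures together with a
collection of `L`-embeddings between them, containing all identity embeddings and closed
under composition. -/
structure PotSys.{u, v, w, x} (L : FirstOrder.Language.{u, v})
    extends PreSys.{u, v, w, x} L where
  Emb : ∀ W W' : World, Set (Dom W ↪[L] Dom W')
  id_mem : ∀ W : World, Embedding.refl L (Dom W) ∈ Emb W W
  comp_mem : ∀ {W W' W'' : World} (f : Dom W ↪[L] Dom W') (g : Dom W' ↪[L] Dom W''),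
    f ∈ Emb W W' → g ∈ Emb W' W'' → g.comp f ∈ Emb W W''

/-- Two tuples (in possibly different structures) satisfy the same atomic `L`-formulas. -/
def AtomicEquiv.{u, v, y, z} (L : FirstOrder.Language.{u, v}) {M : Type y} {N : Type z}
    [L.Structure M] [L.Structure N] {n : ℕ} (a : Fin n → M) (b : Fin n → N) : Prop :=
  ∀ φ : L.Formula (Fin n), BoundedFormula.IsAtomic φ → (φ.Realize a ↔ φ.Realize b)

/-- The type of relations between pairs `(M, ā)` and `(N, b̄)` of equal parameter size. -/
abbrev BisimRel.{u, v, w, x, w', x'} {L : FirstOrder.Language.{u, v}}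
    (S : PotSys.{u, v, w, x} L) (T : PotSys.{u, v, w', x'} L) :=
  ∀ (n : ℕ) (M : S.World), (Fin n → S.Dom M) → ∀ N : T.World, (Fin n → T.Dom N) → Prop

/-- `R` is a bisimulation between the potentialist systems `S` and `T`: it is nonempty, and
whenever `R` relates `(M, ā)` to `(N, b̄)`: (B1) `ā` and `b̄` satisfy the same atomic formulas;
(B2) any extension of either tuple by one element can be matched on the other side;
(B3) any embedding on either side can be matched by an embedding on the other side. -/
def IsBisimulation.{u, v, w, x, w', x'} {L : FirstOrder.Language.{u, v}}
    (S : PotSys.{u, v, w, x} L) (T : PotSys.{u, v, w', x'} L) (R : BisimRel S T) : Prop :=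
  (∃ n M a N b, R n M a N b) ∧
  ∀ (n : ℕ) (M : S.World) (a : Fin n → S.Dom M) (N : T.World) (b : Fin n → T.Dom N),
    R n M a N b →
      AtomicEquiv L a b ∧
      (∀ c : S.Dom M, ∃ d : T.Dom N, R (n + 1) M (Fin.snoc a c) N (Fin.snoc b d)) ∧
      (∀ d : T.Dom N, ∃ c : S.Dom M, R (n + 1) M (Fin.snoc a c) N (Fin.snoc b d)) ∧
      (∀ (M' : S.World) (π : S.Dom M ↪[L] S.Dom M'), π ∈ S.Emb M M' →
        ∃ (N' : T.World) (ρ : T.Dom N ↪[L] T.Dom N'), ρ ∈ T.Emb N N' ∧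
          R n M' (fun i => π (a i)) N' (fun i => ρ (b i))) ∧
      (∀ (N' : T.World) (ρ : T.Dom N ↪[L] T.Dom N'), ρ ∈ T.Emb N N' →
        ∃ (M' : S.World) (π : S.Dom M ↪[L] S.Dom M'), π ∈ S.Emb M M' ∧
          R n M' (fun i => π (a i)) N' (fun i => ρ (b i)))

/-- Two pointed systems are bisimilar if some bisimulation relates them. -/
def Bisimilar.{u, v, w, x, w', x'} {L : FirstOrder.Language.{u, v}}
    (S : PotSys.{u, v, w, x} L) (T : PotSys.{u, v, w', x'} L)
    {n : ℕ} (M : S.World) (a : Fin n → S.Dom M) (N : T.World) (b : Fin n → T.Dom N) : Prop :=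
  ∃ R : BisimRel S T, IsBisimulation S T R ∧ R n M a N b

/-- A relation is bitotal if every pair on the left is related to some pair on the right
and vice versa. -/
def Bitotal.{u, v, w, x, w', x'} {L : FirstOrder.Language.{u, v}}
    (S : PotSys.{u, v, w, x} L) (T : PotSys.{u, v, w', x'} L) (R : BisimRel S T) : Prop :=
  (∀ (n : ℕ) (M : S.World) (a : Fin n → S.Dom M), ∃ N b, R n M a N b) ∧
  (∀ (n : ℕ) (N : T.World) (b : Fin n → T.Dom N), ∃ M a, R n M a N b)

/-- Two potentialist systems are bitotally bisimilar if there is a bitotal bisimulation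
between them. -/
def BitotallyBisimilar.{u, v, w, x, w', x'} {L : FirstOrder.Language.{u, v}}
    (S : PotSys.{u, v, w, x} L) (T : PotSys.{u, v, w', x'} L) : Prop :=
  ∃ R : BisimRel S T, IsBisimulation S T R ∧ Bitotal S T R

/-- An iso-bisimulation between potentialist systems: a nonempty relation between worlds
together with a system of isomorphisms, such that embeddings on either side can be matched
by embeddings on the other side, commuting with the isomorphisms. -/
structure IsoBisim.{u, v, w, x, w', x'} {L : FirstOrder.Language.{u, v}}
    (S : PotSys.{u, v, w, x} L) (T : PotSys.{u, v, w', x'} L) where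
  rel : S.World → T.World → Prop
  nonempty : ∃ M N, rel M N
  iso : ∀ {M : S.World} {N : T.World}, rel M N → (S.Dom M ≃[L] T.Dom N)
  forth : ∀ {M : S.World} {N : T.World} (h : rel M N) (M' : S.World)
      (π : S.Dom M ↪[L] S.Dom M'), π ∈ S.Emb M M' →
      ∃ (N' : T.World) (ρ : T.Dom N ↪[L] T.Dom N') (_ : ρ ∈ T.Emb N N') (h' : rel M' N'),
        ∀ y : S.Dom M, iso h' (π y) = ρ (iso h y)
  back : ∀ {M : S.World} {N : T.World} (h : rel M N) (N' : T.World)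
      (ρ : T.Dom N ↪[L] T.Dom N'), ρ ∈ T.Emb N N' →
      ∃ (M' : S.World) (π : S.Dom M ↪[L] S.Dom M') (_ : π ∈ S.Emb M M') (h' : rel M' N'),
        ∀ y : S.Dom M, iso h' (π y) = ρ (iso h y)

/-- An iso-bisimulation is bitotal if every world on either side takes part in the relation. -/
def IsoBisim.Bitotal.{u, v, w, x, w', x'} {L : FirstOrder.Language.{u, v}}
    {S : PotSys.{u, v, w, x} L} {T : PotSys.{u, v, w', x'} L} (I : IsoBisim S T) : Prop :=
  (∀ M : S.World, ∃ N, I.rel M N) ∧ (∀ N : T.World, ∃ M, I.rel M N)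


/-- Formulas of the infinitary modal language `L^◇_∞`, with free variables among `Fin n`:
built from atomic `L`-formulas by negation, conjunctions and disjunctions indexed by an
arbitrary type (so that each formula has only finitely many free variables), quantifiers,
and the modal operators `◇` and `□`. -/
inductive MFormula.{t, u, v} (L : FirstOrder.Language.{u, v}) : ℕ → Type (max u v (t + 1))
  | equal {n : ℕ} (t₁ t₂ : L.Term (Fin n)) : MFormula L n
  | rel {n l : ℕ} (R : L.Relations l) (ts : Fin l → L.Term (Fin n)) : MFormula L n
  | not {n : ℕ} (φ : MFormula L n) : MFormula L n
  | iAll {n : ℕ} {ι : Type t} (φ : ι → MFormula L n) : MFormula L n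
  | iEx {n : ℕ} {ι : Type t} (φ : ι → MFormula L n) : MFormula L n
  | all {n : ℕ} (φ : MFormula L (n + 1)) : MFormula L n
  | ex {n : ℕ} (φ : MFormula L (n + 1)) : MFormula L n
  | box {n : ℕ} (φ : MFormula L n) : MFormula L n
  | dia {n : ℕ} (φ : MFormula L n) : MFormula L n

/-- Satisfaction of an `L^◇_∞`-formula at a world of a potentialist system, with a tuple of
parameters: `◇φ` holds iff `φ` holds at the image of the parameters under some embedding of
the system, and `□φ` holds iff `φ` holds under every such embedding. -/
def Sat.{t, u, v, w, x} {L : FirstOrder.Language.{u, v}} (S : PotSys.{u, v, w, x} L) :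
    {n : ℕ} → (W : S.World) → (Fin n → S.Dom W) → MFormula.{t, u, v} L n → Prop
  | _, _, a, .equal t₁ t₂ => t₁.realize a = t₂.realize a
  | _, _, a, .rel R ts => Structure.RelMap R fun i => (ts i).realize a
  | _, W, a, .not φ => ¬ Sat S W a φ
  | _, W, a, .iAll φ => ∀ i, Sat S W a (φ i)
  | _, W, a, .iEx φ => ∃ i, Sat S W a (φ i)
  | _, W, a, .all φ => ∀ c, Sat S W (Fin.snoc a c) φ
  | _, W, a, .ex φ => ∃ c, Sat S W (Fin.snoc a c) φ
  | _, W, a, .box φ => ∀ (W' : S.World) (π : S.Dom W ↪[L] S.Dom W'),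
      π ∈ S.Emb W W' → Sat S W' (fun i => π (a i)) φ
  | _, W, a, .dia φ => ∃ (W' : S.World) (π : S.Dom W ↪[L] S.Dom W'),
      π ∈ S.Emb W W' ∧ Sat S W' (fun i => π (a i)) φ

/-- The modal-quantifier rank of an `L^◇_∞`-formula: atomic formulas have rank `0`;
negation preserves rank; conjunctions and disjunctions take the supremum of the ranks;
quantifiers and modal operators add `1`. -/
noncomputable def mqrank.{t, u, v} {L : FirstOrder.Language.{u, v}} :
    {n : ℕ} → MFormula.{t, u, v} L n → Ordinal.{t}
  | _, .equal _ _ => 0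
  | _, .rel _ _ => 0
  | _, .not φ => mqrank φ
  | _, .iAll φ => ⨆ i, mqrank (φ i)
  | _, .iEx φ => ⨆ i, mqrank (φ i)
  | _, .all φ => mqrank φ + 1
  | _, .ex φ => mqrank φ + 1
  | _, .box φ => mqrank φ + 1
  | _, .dia φ => mqrank φ + 1

/-- The type of ordinal-indexed families of relations between pairs `(M, ā)` and `(N, b̄)`. -/
abbrev AlphaBisimRel.{r, u, v, w, x, w', x'} {L : FirstOrder.Language.{u, v}}
    (S : PotSys.{u, v, w, x} L) (T : PotSys.{u, v, w', x'} L) :=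
  Ordinal.{r} → ∀ (n : ℕ) (M : S.World), (Fin n → S.Dom M) → ∀ N : T.World, (Fin n → T.Dom N) → Prop

/-- `R` is an `α`-bisimulation between `S` and `T`: a family of nonempty relations `R β`
for `β ≤ α` such that whenever `R β` relates `(M, ā)` to `(N, b̄)`: (αB1) `ā` and `b̄` satisfy
the same atomic formulas; (αB2) for every `γ < β`, any one-element extension of either tuple
can be matched by the other at level `γ`; (αB3) for every `γ < β`, any embedding on either
side can be matched by one on the other side at level `γ`. -/
def IsAlphaBisimulation.{r, u, v, w, x, w', x'} {L : FirstOrder.Language.{u, v}}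
    (S : PotSys.{u, v, w, x} L) (T : PotSys.{u, v, w', x'} L) (α : Ordinal.{r})
    (R : AlphaBisimRel.{r} S T) : Prop :=
  (∀ β ≤ α, ∃ n M a N b, R β n M a N b) ∧
  ∀ β ≤ α, ∀ (n : ℕ) (M : S.World) (a : Fin n → S.Dom M) (N : T.World) (b : Fin n → T.Dom N),
    R β n M a N b →
      AtomicEquiv L a b ∧
      (∀ γ < β, ∀ c : S.Dom M, ∃ d : T.Dom N,
        R γ (n + 1) M (Fin.snoc a c) N (Fin.snoc b d)) ∧
      (∀ γ < β, ∀ d : T.Dom N, ∃ c : S.Dom M,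
        R γ (n + 1) M (Fin.snoc a c) N (Fin.snoc b d)) ∧
      (∀ γ < β, ∀ (M' : S.World) (π : S.Dom M ↪[L] S.Dom M'), π ∈ S.Emb M M' →
        ∃ (N' : T.World) (ρ : T.Dom N ↪[L] T.Dom N'), ρ ∈ T.Emb N N' ∧
          R γ n M' (fun i => π (a i)) N' (fun i => ρ (b i))) ∧
      (∀ γ < β, ∀ (N' : T.World) (ρ : T.Dom N ↪[L] T.Dom N'), ρ ∈ T.Emb N N' →
        ∃ (M' : S.World) (π : S.Dom M ↪[L] S.Dom M'), π ∈ S.Emb M M' ∧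
          R γ n M' (fun i => π (a i)) N' (fun i => ρ (b i)))

/-- Two pointed systems are `α`-bisimilar if some `α`-bisimulation relates them at level `α`. -/
def AlphaBisimilar.{r, u, v, w, x, w', x'} {L : FirstOrder.Language.{u, v}}
    (S : PotSys.{u, v, w, x} L) (T : PotSys.{u, v, w', x'} L) (α : Ordinal.{r})
    {n : ℕ} (M : S.World) (a : Fin n → S.Dom M) (N : T.World) (b : Fin n → T.Dom N) : Prop :=
  ∃ R : AlphaBisimRel.{r} S T, IsAlphaBisimulation S T α R ∧ R α n M a N b

/-- `RankGE S T α n M a N b` expresses that the position `(M, ā, N, b̄)` of the modal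
Ehrenfeucht–Fraïssé game board between `S` and `T` has rank at least `α`: the tuples satisfy
the same atomic formulas, and for every `β < α`, every move of Abelard from this position
(choosing an element on either side, or an embedding on either side) can be answered by
Eloise reaching a position of rank at least `β`. -/
def RankGE.{r, u, v, w, x, w', x'} {L : FirstOrder.Language.{u, v}}
    (S : PotSys.{u, v, w, x} L) (T : PotSys.{u, v, w', x'} L) (α : Ordinal.{r})
    (n : ℕ) (M : S.World) (a : Fin n → S.Dom M) (N : T.World) (b : Fin n → T.Dom N) : Prop :=
  AtomicEquiv L a b ∧
  ∀ β < α,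
    (∀ c : S.Dom M, ∃ d : T.Dom N,
      RankGE S T β (n + 1) M (Fin.snoc a c) N (Fin.snoc b d)) ∧
    (∀ d : T.Dom N, ∃ c : S.Dom M,
      RankGE S T β (n + 1) M (Fin.snoc a c) N (Fin.snoc b d)) ∧
    (∀ (M' : S.World) (π : S.Dom M ↪[L] S.Dom M'), π ∈ S.Emb M M' →
      ∃ (N' : T.World) (ρ : T.Dom N ↪[L] T.Dom N'), ρ ∈ T.Emb N N' ∧
        RankGE S T β n M' (fun i => π (a i)) N' (fun i => ρ (b i))) ∧
    (∀ (N' : T.World) (ρ : T.Dom N ↪[L] T.Dom N'), ρ ∈ T.Emb N N' →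
      ∃ (M' : S.World) (π : S.Dom M ↪[L] S.Dom M'), π ∈ S.Emb M M' ∧
        RankGE S T β n M' (fun i => π (a i)) N' (fun i => ρ (b i)))
termination_by α


namespace MFormula

open Classical in
/-- The conjunction of a small set of formulas (the empty conjunction if the set is large). -/
noncomputable def conj.{t, u, v} {L : FirstOrder.Language.{u, v}} {n : ℕ}
    (X : Set (MFormula.{t, u, v} L n)) : MFormula.{t, u, v} L n :=
  if _ : Small.{t} X then .iAll fun i : Shrink.{t} X => ((equivShrink X).symm i).1
  else .iAll fun i : PEmpty.{t + 1} => i.elim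

/-- The disjunction of a small set of formulas. -/
noncomputable def disj.{t, u, v} {L : FirstOrder.Language.{u, v}} {n : ℕ}
    (X : Set (MFormula.{t, u, v} L n)) : MFormula.{t, u, v} L n :=
  .not (conj (MFormula.not '' X))

/-- The modal formula corresponding to an atomic first-order formula. -/
def ofAtomic.{t, u, v} {L : FirstOrder.Language.{u, v}} {n : ℕ} :
    L.Formula (Fin n) → MFormula.{t, u, v} L n
  | .equal t₁ t₂ =>
      .equal (t₁.relabel (Sum.elim id Fin.elim0)) (t₂.relabel (Sum.elim id Fin.elim0))
  | .rel R ts => .rel R fun i => (ts i).relabel (Sum.elim id Fin.elim0)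
  | _ => .iAll fun i : PEmpty.{t + 1} => i.elim

open Classical in
/-- The formula asserting that an atomic formula `φ` has the truth value prescribed by `D`. -/
noncomputable def literal.{t, u, v} {L : FirstOrder.Language.{u, v}} {n : ℕ}
    (D : Set {φ : L.Formula (Fin n) // BoundedFormula.IsAtomic φ})
    (φ : {φ : L.Formula (Fin n) // BoundedFormula.IsAtomic φ}) : MFormula.{t, u, v} L n :=
  if φ ∈ D then ofAtomic φ.1 else .not (ofAtomic φ.1)

/-- The back-and-forth conditions given by a set `E` of formulas to be realized by one-element
extensions and a set `P` of formulas to be realized along embeddings. -/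
def backForth.{t, u, v} {L : FirstOrder.Language.{u, v}} {n : ℕ}
    (E : Set (MFormula.{t, u, v} L (n + 1))) (P : Set (MFormula.{t, u, v} L n)) :
    Set (MFormula.{t, u, v} L n) :=
  MFormula.ex '' E ∪ {.all (disj E)} ∪ (MFormula.dia '' P ∪ {.box (disj P)})

/-- The Hintikka formula assembled from an atomic diagram and from the sets of Hintikka formulas
of smaller rank realized by one-element extensions and along embeddings. -/
noncomputable def assemble.{t, u, v} {L : FirstOrder.Language.{u, v}} {n : ℕ} (α : Ordinal.{t})
    (D : Set {φ : L.Formula (Fin n) // BoundedFormula.IsAtomic φ})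
    (E : Set.Iio α → Set (MFormula.{t, u, v} L (n + 1)))
    (P : Set.Iio α → Set (MFormula.{t, u, v} L n)) : MFormula.{t, u, v} L n :=
  conj (Set.range (literal D) ∪ ⋃ β, backForth (E β) (P β))

end MFormula

/-- The embeddings of a potentialist system with a given source. -/
def PotSys.EmbFrom.{u, v, w, x} {L : FirstOrder.Language.{u, v}} (S : PotSys.{u, v, w, x} L)
    (M : S.World) : Type (max w x) :=
  {p : Σ M' : S.World, S.Dom M ↪[L] S.Dom M' // p.2 ∈ S.Emb M p.1}

/-- The Hintikka formula of rank `α` of a pointed system. -/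
noncomputable def hintikka.{t, u, v, w, x} {L : FirstOrder.Language.{u, v}}
    (S : PotSys.{u, v, w, x} L) (α : Ordinal.{t}) (n : ℕ) (M : S.World) (a : Fin n → S.Dom M) :
    MFormula.{t, u, v} L n :=
  .assemble α {φ | φ.1.Realize a}
    (fun β => Set.range fun c => hintikka S β.1 (n + 1) M (Fin.snoc a c))
    (fun β => Set.range fun p : S.EmbFrom M => hintikka S β.1 n p.1.1 fun i => p.1.2 (a i))
termination_by α
decreasing_by all_goals exact β.2

section Formulas

universe t u v w x

variable {L : FirstOrder.Language.{u, v}} {n : ℕ}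

open MFormula

theorem sat_conj (S : PotSys.{u, v, w, x} L) {W : S.World} {a : Fin n → S.Dom W}
    {X : Set (MFormula.{t, u, v} L n)} [h : Small.{t} X] :
    Sat S W a (conj X) ↔ ∀ φ ∈ X, Sat S W a φ := by
  rw [conj, dif_pos h]
  simp only [Sat]
  rw [(equivShrink X).symm.forall_congr_left]
  simp

theorem sat_disj (S : PotSys.{u, v, w, x} L) {W : S.World} {a : Fin n → S.Dom W}
    {X : Set (MFormula.{t, u, v} L n)} [Small.{t} X] :
    Sat S W a (disj X) ↔ ∃ φ ∈ X, Sat S W a φ := by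
  simp [disj, Sat, sat_conj]

theorem mqrank_conj_le {X : Set (MFormula.{t, u, v} L n)} {α : Ordinal.{t}}
    (h : ∀ φ ∈ X, mqrank φ ≤ α) : mqrank (conj X) ≤ α := by
  unfold conj
  split_ifs
  · exact ciSup_le' fun i => h _ (Subtype.prop _)
  · exact ciSup_le' fun i => i.elim

theorem le_mqrank_conj {X : Set (MFormula.{t, u, v} L n)} [h : Small.{t} X]
    {φ : MFormula.{t, u, v} L n} (hφ : φ ∈ X) : mqrank φ ≤ mqrank (conj X) := by
  rw [conj, dif_pos h]
  have := Ordinal.le_iSup (fun i : Shrink.{t} X => mqrank ((equivShrink X).symm i).1)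
    (equivShrink X ⟨φ, hφ⟩)
  simpa [mqrank] using this

theorem mqrank_disj_le {X : Set (MFormula.{t, u, v} L n)} {α : Ordinal.{t}}
    (h : ∀ φ ∈ X, mqrank φ ≤ α) : mqrank (disj X) ≤ α := by
  rw [disj, mqrank]
  exact mqrank_conj_le (by simpa [mqrank] using h)

theorem sat_ofAtomic (S : PotSys.{u, v, w, x} L) {W : S.World} {a : Fin n → S.Dom W}
    {φ : L.Formula (Fin n)} (hφ : BoundedFormula.IsAtomic φ) :
    Sat S W a (ofAtomic.{t} φ) ↔ φ.Realize a := by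
  have key : a ∘ Sum.elim id Fin.elim0 = Sum.elim a (default : Fin 0 → S.Dom W) := by
    ext i
    rcases i with i | i
    · rfl
    · exact i.elim0
  cases hφ with
  | equal t₁ t₂ =>
    simp [Term.bdEqual, ofAtomic, Sat, Formula.Realize, BoundedFormula.Realize, key]
  | rel R ts =>
    simp [Relations.boundedFormula, ofAtomic, Sat, Formula.Realize, BoundedFormula.Realize, key]

theorem mqrank_literal (D : Set {φ : L.Formula (Fin n) // BoundedFormula.IsAtomic φ})
    (φ : {φ : L.Formula (Fin n) // BoundedFormula.IsAtomic φ}) :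
    mqrank (literal.{t} D φ) = 0 := by
  have h : mqrank (ofAtomic.{t} φ.1) = 0 := by
    obtain ⟨φ, hφ⟩ := φ
    cases hφ <;> rfl
  unfold literal
  split_ifs <;> simpa [mqrank] using h

theorem sat_literals (S : PotSys.{u, v, w, x} L) {W : S.World} {b : Fin n → S.Dom W}
    {D : Set {φ : L.Formula (Fin n) // BoundedFormula.IsAtomic φ}} :
    (∀ ψ ∈ Set.range (literal.{t} D), Sat S W b ψ) ↔
      ∀ φ : {φ : L.Formula (Fin n) // BoundedFormula.IsAtomic φ}, φ ∈ D ↔ φ.1.Realize b := by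
  rw [Set.forall_mem_range]
  refine forall_congr' fun φ => ?_
  unfold literal
  split_ifs with h <;> simp [Sat, sat_ofAtomic S φ.2, h]

theorem sat_backForth (S : PotSys.{u, v, w, x} L) {W : S.World} {b : Fin n → S.Dom W}
    {E : Set (MFormula.{t, u, v} L (n + 1))} {P : Set (MFormula.{t, u, v} L n)}
    [Small.{t} E] [Small.{t} P] :
    (∀ ψ ∈ backForth E P, Sat S W b ψ) ↔
      (∀ φ ∈ E, ∃ d, Sat S W (Fin.snoc b d) φ) ∧
      (∀ d, ∃ φ ∈ E, Sat S W (Fin.snoc b d) φ) ∧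
      (∀ φ ∈ P, ∃ (W' : S.World) (ρ : S.Dom W ↪[L] S.Dom W'), ρ ∈ S.Emb W W' ∧
        Sat S W' (fun i => ρ (b i)) φ) ∧
      (∀ (W' : S.World) (ρ : S.Dom W ↪[L] S.Dom W'), ρ ∈ S.Emb W W' →
        ∃ φ ∈ P, Sat S W' (fun i => ρ (b i)) φ) := by
  simp only [backForth, Set.union_singleton, Set.mem_union, Set.mem_insert_iff, or_imp,
    forall_and, forall_eq, Set.forall_mem_image, Sat, sat_disj]
  tauto

end Formulas

section Hintikka

universe r u v w x

variable {L : FirstOrder.Language.{u, v}} (S : PotSys.{u, v, w, x} L)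

open MFormula

/-- The Hintikka formulas of rank `α` of the pointed systems of parameter size `n` over `S`. -/
def hintikkaSet.{t} (α : Ordinal.{t}) (n : ℕ) : Set (MFormula.{t, u, v} L n) :=
  Set.range fun p : Σ M : S.World, Fin n → S.Dom M => hintikka S α n p.1 p.2

theorem hintikka_mem_hintikkaSet.{t} (α : Ordinal.{t}) {n : ℕ} (M : S.World)
    (a : Fin n → S.Dom M) : hintikka S α n M a ∈ hintikkaSet S α n :=
  ⟨⟨M, a⟩, rfl⟩

theorem small_hintikkaSet (α : Ordinal.{max u v r}) (n : ℕ) :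
    Small.{max u v r} (hintikkaSet S α n) := by
  induction α using WellFoundedLT.induction generalizing n with
  | ind α ih =>
  have hR (β : Set.Iio α) (m : ℕ) : Small.{max u v r} (hintikkaSet S β.1 m) := ih β.1 β.2 m
  have hA : Small.{max u v r} {φ : L.Formula (Fin n) // BoundedFormula.IsAtomic φ} :=
    small_max.{r, max u v} _
  let f (q : Set {φ : L.Formula (Fin n) // BoundedFormula.IsAtomic φ} ×
      (∀ β : Set.Iio α, Set (hintikkaSet S β.1 (n + 1))) ×
      (∀ β : Set.Iio α, Set (hintikkaSet S β.1 n))) :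
      MFormula.{max u v r, u, v} L n :=
    assemble α q.1 (fun β => Subtype.val '' q.2.1 β) (fun β => Subtype.val '' q.2.2 β)
  refine small_subset (s := Set.range f) ?_
  rintro _ ⟨⟨M, a⟩, rfl⟩
  refine ⟨⟨{φ | φ.1.Realize a}, fun β => Set.range fun c =>
      ⟨_, hintikka_mem_hintikkaSet S β.1 M (Fin.snoc a c)⟩,
    fun β => Set.range fun p : S.EmbFrom M =>
      ⟨_, hintikka_mem_hintikkaSet S β.1 p.1.1 fun i => p.1.2 (a i)⟩⟩, ?_⟩
  simp only [f, ← Set.range_comp, Function.comp_def]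
  rw [hintikka]

theorem small_hintikka_extensions (α : Ordinal.{max u v r}) {n : ℕ} (M : S.World)
    (a : Fin n → S.Dom M) :
    Small.{max u v r} (Set.range fun c => hintikka S α (n + 1) M (Fin.snoc a c)) := by
  have := small_hintikkaSet.{r} S α (n + 1)
  refine small_subset (s := hintikkaSet S α (n + 1)) ?_
  rintro _ ⟨c, rfl⟩
  exact hintikka_mem_hintikkaSet S α _ _

theorem small_hintikka_embeddings (α : Ordinal.{max u v r}) {n : ℕ} (M : S.World)
    (a : Fin n → S.Dom M) :
    Small.{max u v r}
      (Set.range fun p : S.EmbFrom M => hintikka S α n p.1.1 fun i => p.1.2 (a i)) := by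
  have := small_hintikkaSet.{r} S α n
  refine small_subset (s := hintikkaSet S α n) ?_
  rintro _ ⟨p, rfl⟩
  exact hintikka_mem_hintikkaSet S α _ _

theorem small_assemble {n : ℕ} {α : Ordinal.{max u v r}}
    (D : Set {φ : L.Formula (Fin n) // BoundedFormula.IsAtomic φ})
    (E : Set.Iio α → Set (MFormula.{max u v r, u, v} L (n + 1)))
    (P : Set.Iio α → Set (MFormula.{max u v r, u, v} L n))
    [∀ β, Small.{max u v r} (E β)] [∀ β, Small.{max u v r} (P β)] :
    Small.{max u v r} ↥(Set.range (literal D) ∪ ⋃ β, backForth (E β) (P β)) := by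
  have hA : Small.{max u v r} {φ : L.Formula (Fin n) // BoundedFormula.IsAtomic φ} :=
    small_max.{r, max u v} _
  have hB (β : Set.Iio α) : Small.{max u v r} (backForth (E β) (P β)) := by
    unfold backForth
    infer_instance
  infer_instance

theorem mqrank_hintikka (α : Ordinal.{max u v r}) {n : ℕ} (M : S.World) (a : Fin n → S.Dom M) :
    mqrank (hintikka S α n M a) = α := by
  induction α using WellFoundedLT.induction generalizing n M with
  | ind α ih =>
  have hE (β : Ordinal.{max u v r}) := small_hintikka_extensions.{r} S β M a
  have hP (β : Ordinal.{max u v r}) := small_hintikka_embeddings.{r} S β M a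
  rw [hintikka, assemble]
  apply le_antisymm
  · apply mqrank_conj_le
    rintro φ (⟨ψ, rfl⟩ | hφ)
    · simp [mqrank_literal]
    obtain ⟨⟨β, hβ⟩, hφ⟩ := Set.mem_iUnion.1 hφ
    refine le_trans ?_ (Order.add_one_le_of_lt hβ)
    obtain (⟨_, ⟨c, rfl⟩, rfl⟩ | rfl) | (⟨_, ⟨p, rfl⟩, rfl⟩ | rfl) := hφ <;> rw [mqrank] <;> gcongr
    · exact (ih β hβ _ _).le
    · exact mqrank_disj_le (Set.forall_mem_range.2 fun c => (ih β hβ _ _).le)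
    · exact (ih β hβ _ _).le
    · exact mqrank_disj_le (Set.forall_mem_range.2 fun p => (ih β hβ _ _).le)
  · refine le_of_forall_lt fun β hβ => ?_
    have := small_assemble.{r} (α := α) {φ | φ.1.Realize a}
      (fun β => Set.range fun c => hintikka S β.1 (n + 1) M (Fin.snoc a c))
      (fun β => Set.range fun p : S.EmbFrom M => hintikka S β.1 n p.1.1 fun i => p.1.2 (a i))
    refine lt_of_lt_of_le ?_ (le_mqrank_conj (φ := dia (hintikka S β n M a))
      (Or.inr (Set.mem_iUnion_of_mem ⟨β, hβ⟩ (Or.inr (Or.inl ⟨_, ⟨⟨⟨M, Embedding.refl L _⟩,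
        S.id_mem M⟩, rfl⟩, rfl⟩)))))
    rw [mqrank, ih β hβ]
    exact Order.lt_add_one_iff.2 le_rfl

theorem sat_hintikka_iff.{w', x'} (T : PotSys.{u, v, w', x'} L) (α : Ordinal.{max u v r}) {n : ℕ}
    (M : S.World) (a : Fin n → S.Dom M) (N : T.World) (b : Fin n → T.Dom N) :
    Sat T N b (hintikka S α n M a) ↔ RankGE S T α n M a N b := by
  induction α using WellFoundedLT.induction generalizing n M N with
  | ind α ih =>
  have hE (β : Ordinal.{max u v r}) := small_hintikka_extensions.{r} S β M a
  have hP (β : Ordinal.{max u v r}) := small_hintikka_embeddings.{r} S β M a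
  have := small_assemble.{r} (α := α) {φ | φ.1.Realize a}
    (fun β => Set.range fun c => hintikka S β.1 (n + 1) M (Fin.snoc a c))
    (fun β => Set.range fun p : S.EmbFrom M => hintikka S β.1 n p.1.1 fun i => p.1.2 (a i))
  rw [hintikka, assemble, sat_conj, RankGE]
  simp only [Set.mem_union, or_imp, forall_and, sat_literals]
  refine and_congr (by simp [AtomicEquiv]) ?_
  simp only [← forall_and, Set.mem_iUnion, forall_exists_index]
  rw [forall_comm]
  simp only [sat_backForth, Subtype.forall, Set.mem_Iio]
  refine forall₂_congr fun β hβ => ?_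
  simp only [Set.forall_mem_range, Set.exists_range_iff, ih β hβ, PotSys.EmbFrom, Subtype.forall,
    Subtype.exists, Sigma.forall, Sigma.exists]
  exact and_congr_right' (and_congr_right' (and_congr_right'
    (forall₃_congr fun _ _ _ => exists₂_congr fun _ _ =>
      ⟨fun ⟨hρ, hr⟩ => ⟨hρ, hr⟩, fun ⟨hρ, hr⟩ => ⟨hρ, hr⟩⟩)))

end Hintikka

/-- for every pointed system `(𝓜, M, ā)` of parameter size `n` and every
ordinal `α`, there is an `L^◇_∞`-formula `θ^{𝓜,M,ā}_α` with `n` free variables, of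
modal-quantifier rank exactly `α`, which holds at a pointed system `(𝓝, N, b̄)` iff the
position `(M, ā, N, b̄)` has rank at least `α` in the game board `MEF(𝓜, 𝓝)`. -/
theorem exists_hintikka_formula.{w', x', u, v, w, x}
    {L : FirstOrder.Language.{u, v}} (S : PotSys.{u, v, w, x} L)
    {n : ℕ} (M : S.World) (a : Fin n → S.Dom M) (α : Ordinal.{max u v x}) :
    ∃ θ : MFormula.{max u v x, u, v} L n, mqrank θ = α ∧
      ∀ (T : PotSys.{u, v, w', x'} L) (N : T.World) (b : Fin n → T.Dom N),
        Sat T N b θ ↔ RankGE S T α n M a N b := by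
  exact ⟨hintikka S α n M a, mqrank_hintikka.{x} S α M a,
    fun T N b => sat_hintikka_iff.{x} S T α M a N b⟩

end Potentialist
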